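/- Let Σ be a symmetric positive definite d × d real matrix, let D be an invertible d × d real matrix, and set Σ' = D Σ Dᵀ. Then for all nonzero u, v ∈ ℝ^d, cos(Σ'^{-1/2} D u, Σ'^{-1/2} D v) = cos(Σ^{-1/2} u, Σ^{-1/2} v); that is, cosine similarity computed after whitening is invariant under arbitrary invertible linear gauge transformations of the representation space. -/

import Mathlib

open Matrix

/-- Cosine similarity: `cos(u,v) = uᵀv / (‖u‖ ‖v‖)` with the Euclidean norm
`‖u‖ = √(uᵀ u)`. -/
noncomputable def cosSim {d : ℕ} (u v : Fin d → ℝ) : ℝ :=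
  (u ⬝ᵥ v) / (Real.sqrt (u ⬝ᵥ u) * Real.sqrt (v ⬝ᵥ v))

/-- Whitening by the inverse of a symmetric `S` turns the dot product into the bilinear form
of `(S * S)⁻¹`. -/
theorem dotProduct_inv_mulVec_of_isSymm {n R : Type*} [Fintype n] [DecidableEq n] [CommRing R]
    {S : Matrix n n R} (hS : S.IsSymm) (u v : n → R) :
    (S⁻¹ *ᵥ u) ⬝ᵥ (S⁻¹ *ᵥ v) = u ⬝ᵥ ((S * S)⁻¹ *ᵥ v) := by
  rw [Matrix.mul_inv_rev, ← mulVec_mulVec, dotProduct_mulVec u, ← mulVec_transpose,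
    transpose_nonsing_inv, hS.eq]

/-- The bilinear form of the inverse of `A` is unchanged when vectors transform by an invertible
`D` and `A` transforms to `D * A * Dᵀ`. -/
theorem mulVec_dotProduct_inv_conj_mulVec {n R : Type*} [Fintype n] [DecidableEq n] [CommRing R]
    (A : Matrix n n R) {D : Matrix n n R} (hD : IsUnit D) (u v : n → R) :
    (D *ᵥ u) ⬝ᵥ ((D * A * Dᵀ)⁻¹ *ᵥ (D *ᵥ v)) = u ⬝ᵥ (A⁻¹ *ᵥ v) := by
  have hdet : IsUnit D.det := (isUnit_iff_isUnit_det D).mp hD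
  have hdetT : IsUnit Dᵀ.det := by rwa [det_transpose]
  rw [← vecMul_transpose, ← dotProduct_mulVec, mulVec_mulVec, mulVec_mulVec,
    Matrix.mul_inv_rev, Matrix.mul_inv_rev, mul_nonsing_inv_cancel_left _ _ hdetT,
    nonsing_inv_mul_cancel_right _ _ hdet]

/-- **Whitened cosine similarity is gauge invariant.**
Let `Sig` be symmetric positive definite with symmetric positive definite
square root `S` (`S * S = Sig`, so `Sig^{-1/2} = S⁻¹`), let `D` be invertible,
and let `Sig' = D Sig Dᵀ` with symmetric positive definite square root `S'`
(`Sig'^{-1/2} = S'⁻¹`).  Then for all nonzero `u, v`,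
`cos(Sig'^{-1/2} D u, Sig'^{-1/2} D v) = cos(Sig^{-1/2} u, Sig^{-1/2} v)`. -/
theorem whitened_cosSim_gauge_invariant
    {d : ℕ} (Sig : Matrix (Fin d) (Fin d) ℝ)
    (hSigsymm : Sig.IsSymm) (hSigpd : Sig.PosDef)
    (D : Matrix (Fin d) (Fin d) ℝ) (hD : IsUnit D)
    (Sig' : Matrix (Fin d) (Fin d) ℝ) (hSig' : Sig' = D * Sig * Dᵀ)
    (S : Matrix (Fin d) (Fin d) ℝ)
    (hSsymm : S.IsSymm) (hSpd : S.PosDef) (hSS : S * S = Sig)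
    (S' : Matrix (Fin d) (Fin d) ℝ)
    (hS'symm : S'.IsSymm) (hS'pd : S'.PosDef) (hS'S' : S' * S' = Sig') :
    ∀ u v : Fin d → ℝ, u ≠ 0 → v ≠ 0 →
      cosSim (S'⁻¹.mulVec (D.mulVec u)) (S'⁻¹.mulVec (D.mulVec v)) =
        cosSim (S⁻¹.mulVec u) (S⁻¹.mulVec v) := by
  intro u v _ _
  have hdot (x y : Fin d → ℝ) :
      (S'⁻¹ *ᵥ (D *ᵥ x)) ⬝ᵥ (S'⁻¹ *ᵥ (D *ᵥ y)) = (S⁻¹ *ᵥ x) ⬝ᵥ (S⁻¹ *ᵥ y) := by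
    rw [dotProduct_inv_mulVec_of_isSymm hS'symm, dotProduct_inv_mulVec_of_isSymm hSsymm,
      hS'S', hSS, hSig', mulVec_dotProduct_inv_conj_mulVec Sig hD]
  simp only [cosSim, hdot]
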